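/- Let Y be a finite-dimensional linear subspace of ℓ₁. Then Y has property-(SU) in ℓ₁ if and only if Y has property-(U) in ℓ₁ and Y is isometrically isomorphic to ℓ₁(dim Y). -/

import Mathlib

open scoped ENNReal

noncomputable section

/-- The annihilator of a subspace `Y` in the continuous dual. -/
def annih {X : Type*} [NormedAddCommGroup X] [NormedSpace ℝ X] (Y : Submodule ℝ X) :
    Submodule ℝ (X →L[ℝ] ℝ) where
  carrier := {f | ∀ y ∈ Y, f y = 0}
  add_mem' := by intro f g hf hg y hy; simp [hf y hy, hg y hy]
  zero_mem' := by intro y hy; simp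
  smul_mem' := by intro c f hf y hy; simp [hf y hy]

/-- `F` is a norm-preserving extension of `f : Y* → ℝ`. -/
def IsNPExtension {X : Type*} [NormedAddCommGroup X] [NormedSpace ℝ X] (Y : Submodule ℝ X)
    (f : Y →L[ℝ] ℝ) (F : X →L[ℝ] ℝ) : Prop :=
  (∀ y : Y, F y = f y) ∧ ‖F‖ = ‖f‖

/-- property-(U) -/
def PropU {X : Type*} [NormedAddCommGroup X] [NormedSpace ℝ X] (Y : Submodule ℝ X) : Prop :=
  ∀ f : Y →L[ℝ] ℝ, ∃! F : X →L[ℝ] ℝ, IsNPExtension Y f F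

/-- property-(wU) -/
def PropwU {X : Type*} [NormedAddCommGroup X] [NormedSpace ℝ X] (Y : Submodule ℝ X) : Prop :=
  ∀ f : Y →L[ℝ] ℝ, (∃ y₀ : Y, ‖y₀‖ = 1 ∧ ‖f‖ = |f y₀|) →
    ∃! F : X →L[ℝ] ℝ, IsNPExtension Y f F

/-- property-(SU) -/
def PropSU {X : Type*} [NormedAddCommGroup X] [NormedSpace ℝ X] (Y : Submodule ℝ X) : Prop :=
  ∃ G : Submodule ℝ (X →L[ℝ] ℝ), IsClosed (G : Set (X →L[ℝ] ℝ)) ∧ IsCompl G (annih Y) ∧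
    ∀ g ∈ G, ∀ h ∈ annih Y, h ≠ 0 → ‖g‖ < ‖g + h‖

/-- property-(HB) -/
def PropHB {X : Type*} [NormedAddCommGroup X] [NormedSpace ℝ X] (Y : Submodule ℝ X) : Prop :=
  ∃ G : Submodule ℝ (X →L[ℝ] ℝ), IsClosed (G : Set (X →L[ℝ] ℝ)) ∧ IsCompl G (annih Y) ∧
    ∀ g ∈ G, ∀ h ∈ annih Y, h ≠ 0 → ‖g‖ < ‖g + h‖ ∧ ‖h‖ ≤ ‖g + h‖

/-- M-ideal -/
def MIdeal {X : Type*} [NormedAddCommGroup X] [NormedSpace ℝ X] (Y : Submodule ℝ X) : Prop :=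
  ∃ G : Submodule ℝ (X →L[ℝ] ℝ), IsClosed (G : Set (X →L[ℝ] ℝ)) ∧ IsCompl G (annih Y) ∧
    ∀ g ∈ G, ∀ h ∈ annih Y, ‖g + h‖ = ‖g‖ + ‖h‖




section general
variable {X : Type*} [NormedAddCommGroup X] [NormedSpace ℝ X]

lemma exists_npext (Y : Submodule ℝ X) (f : Y →L[ℝ] ℝ) :
    ∃ F : X →L[ℝ] ℝ, IsNPExtension Y f F := by
  obtain ⟨F, h1, h2⟩ := exists_extension_norm_eq (𝕜 := ℝ) Y f
  exact ⟨F, h1, h2⟩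

lemma norm_le_of_ext (Y : Submodule ℝ X) (f : Y →L[ℝ] ℝ) (F : X →L[ℝ] ℝ)
    (h : ∀ y : Y, F y = f y) : ‖f‖ ≤ ‖F‖ := by
  refine ContinuousLinearMap.opNorm_le_bound _ (norm_nonneg _) fun y => ?_
  rw [← h y]
  exact F.le_opNorm _

lemma su_imp_u (Y : Submodule ℝ X) (h : PropSU Y) : PropU Y := by
  obtain ⟨G, hG, hc, hlt⟩ := h
  have key : ∀ F : X →L[ℝ] ℝ, ∃ g ∈ G, ∃ k ∈ annih Y, g + k = F := by
    intro F
    have : F ∈ G ⊔ annih Y := by rw [hc.sup_eq_top]; trivial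
    exact Submodule.mem_sup.1 this
  intro f
  have key2 : ∀ F, IsNPExtension Y f F → F ∈ G := by
    intro F hF
    obtain ⟨g, hg, k, hk, rfl⟩ := key F
    by_cases hk0 : k = 0
    · simpa [hk0] using hg
    · exfalso
      have h1 := hlt g hg k hk hk0
      have h2 : ‖f‖ ≤ ‖g‖ := norm_le_of_ext Y f g fun y => by
        rw [← hF.1 y]; simp [hk y y.2]
      rw [hF.2] at h1
      linarith
  obtain ⟨F, hF⟩ := exists_npext Y f
  refine ⟨F, hF, fun F' hF' => ?_⟩
  have h1 : F' - F ∈ G := G.sub_mem (key2 _ hF') (key2 _ hF)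
  have h2 : F' - F ∈ annih Y := fun y hy => by
    have a := hF.1 ⟨y, hy⟩
    have b := hF'.1 ⟨y, hy⟩
    simp only at a b
    simp [a, b]
  exact sub_eq_zero.1 (Submodule.disjoint_def.1 hc.disjoint _ h1 h2)

lemma su_imp_proj (Y : Submodule ℝ X) [FiniteDimensional ℝ Y] (h : PropSU Y) :
    ∃ P : X →ₗ[ℝ] Y, (∀ y : Y, P y = y) ∧ ∀ x, ‖P x‖ ≤ ‖x‖ := by
  obtain ⟨G, hG, hc, hlt⟩ := h
  have key : ∀ F : X →L[ℝ] ℝ, ∃ g ∈ G, ∃ k ∈ annih Y, g + k = F := by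
    intro F
    have : F ∈ G ⊔ annih Y := by rw [hc.sup_eq_top]; trivial
    exact Submodule.mem_sup.1 this
  let b := Module.finBasis ℝ Y
  have h1 : ∀ i, ∃ g ∈ G, ∀ y : Y, g y = b.repr y i := by
    intro i
    obtain ⟨F, hF⟩ := exists_npext Y (LinearMap.toContinuousLinearMap (b.coord i))
    obtain ⟨g, hg, k, hk, rfl⟩ := key F
    refine ⟨g, hg, fun y => ?_⟩
    have := hF.1 y
    simpa [hk y y.2] using this
  choose g hgG hg using h1
  refine ⟨∑ i, (g i).toLinearMap.smulRight (b i), fun y => ?_, fun x => ?_⟩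
  · simp only [LinearMap.sum_apply, LinearMap.smulRight_apply, ContinuousLinearMap.coe_coe, hg]
    exact b.sum_repr y
  · refine NormedSpace.norm_le_dual_bound ℝ _ (norm_nonneg _) fun f => ?_
    let T : X →L[ℝ] ℝ := ∑ i, f (b i) • g i
    have hT : T ∈ G := G.sum_mem fun i _ => G.smul_mem _ (hgG i)
    have e : f ((∑ i, (g i).toLinearMap.smulRight (b i)) x) = T x := by
      simp [T, mul_comm]
    obtain ⟨F, hF⟩ := exists_npext Y f
    have hTY : ∀ y : Y, T y = f y := by
      intro y
      have h3 := congrArg f (b.sum_repr y)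
      rw [map_sum] at h3
      rw [← h3]
      simp [T, hg, mul_comm]
    have hk : F - T ∈ annih Y := fun y hy => by
      have a := hF.1 ⟨y, hy⟩
      have c := hTY ⟨y, hy⟩
      simp only at a c
      simp [a, c]
    have hle : ‖T‖ ≤ ‖f‖ := by
      rw [← hF.2]
      by_cases h0 : F - T = 0
      · rw [sub_eq_zero.1 h0]
      · have := hlt T hT _ hk h0
        simpa using this.le
    rw [e]
    calc ‖T x‖ ≤ ‖T‖ * ‖x‖ := T.le_opNorm x
      _ ≤ ‖f‖ * ‖x‖ := by gcongr
      _ = _ := mul_comm _ _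

lemma proj_imp_su (Y : Submodule ℝ X) [FiniteDimensional ℝ Y] (hU : PropU Y)
    (P : X →ₗ[ℝ] Y) (hP : ∀ y : Y, P y = y) (hn : ∀ x, ‖P x‖ ≤ ‖x‖) : PropSU Y := by
  let Q : X →L[ℝ] Y := P.mkContinuous 1 (by simpa using hn)
  have hQ : ∀ y : Y, Q y = y := hP
  have hQn : ‖Q‖ ≤ 1 := LinearMap.mkContinuous_norm_le _ zero_le_one _
  let T : (Y →L[ℝ] ℝ) →ₗ[ℝ] (X →L[ℝ] ℝ) :=
    { toFun := fun f => f.comp Q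
      map_add' := fun f g => by ext; simp
      map_smul' := fun c f => by ext; simp }
  have hT : ∀ f (y : Y), T f y = f y := fun f y => by simp [T, hQ]
  have hTn : ∀ f, ‖T f‖ = ‖f‖ := fun f => by
    refine le_antisymm ?_ (norm_le_of_ext Y f _ (hT f))
    calc ‖f.comp Q‖ ≤ ‖f‖ * ‖Q‖ := ContinuousLinearMap.opNorm_comp_le _ _
      _ ≤ ‖f‖ * 1 := by gcongr
      _ = ‖f‖ := mul_one _
  refine ⟨LinearMap.range T, Submodule.closed_of_finiteDimensional _, ⟨?_, ?_⟩, ?_⟩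
  · rw [Submodule.disjoint_def]
    rintro _ ⟨f, rfl⟩ hf
    have : f = 0 := by
      ext y
      rw [← hT]; exact hf y y.2
    simp [this]
  · rw [codisjoint_iff, eq_top_iff]
    intro F _
    refine Submodule.mem_sup.2 ⟨T (F.comp Y.subtypeL), ⟨_, rfl⟩,
      F - T (F.comp Y.subtypeL), fun y hy => ?_, by simp⟩
    have := hT (F.comp Y.subtypeL) ⟨y, hy⟩
    simp only at this
    simp [this]
  · rintro _ ⟨f, rfl⟩ k hk hk0
    have hext : ∀ y : Y, (T f + k) y = f y := fun y => by simp [hT, hk y y.2]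
    refine lt_of_le_of_ne ?_ fun he => hk0 ?_
    · rw [hTn]; exact norm_le_of_ext Y f _ hext
    · have := (hU f).unique (y₁ := T f + k) (y₂ := T f) ⟨hext, by rw [← he, hTn]⟩ ⟨hT f, hTn f⟩
      simpa using this

lemma extreme_aux {V : Type*} [NormedAddCommGroup V] [NormedSpace ℝ V] {y v : V} {a : ℝ}
    (hy : y ∈ Set.extremePoints ℝ (Metric.closedBall (0 : V) 1)) (hv : ‖v‖ ≤ 1) (ha : 0 < a)
    (h : ‖y - a • v‖ ≤ 1 - a) : v = y := by
  rcases eq_or_lt_of_le (show a ≤ 1 by linarith [norm_nonneg (y - a • v)]) with rfl | h1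
  · have : y - (1 : ℝ) • v = 0 := by simpa using h
    simpa [eq_comm] using sub_eq_zero.1 this
  · have h1' : 0 < 1 - a := by linarith
    refine ((mem_extremePoints.1 hy).2 v (by simpa using hv) ((1 - a)⁻¹ • (y - a • v)) ?_ ?_).1
    · rw [mem_closedBall_zero_iff, norm_smul, norm_inv, Real.norm_of_nonneg h1'.le]
      rw [inv_mul_le_iff₀ h1']; simpa using h
    · refine ⟨a, 1 - a, ha, h1', by ring, ?_⟩
      rw [smul_inv_smul₀ h1'.ne']; abel

end general

section ell
local notation "L1" => lp (fun _ : ℕ => ℝ) 1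

lemma l1_hasSum (x : L1) : HasSum (fun k => |x k|) ‖x‖ := by
  have := lp.hasSum_norm (p := 1) (by simp) x
  simpa using this

lemma l1_norm_sum {ι : Type*} [Fintype ι] (b : ι → L1)
    (hd : ∀ i j, i ≠ j → ∀ k, b i k = 0 ∨ b j k = 0) (a : ι → ℝ) :
    ‖∑ i, a i • b i‖ = ∑ i, |a i| * ‖b i‖ := by
  have h1 := l1_hasSum (∑ i, a i • b i)
  have h2 : HasSum (fun k => ∑ i, |a i| * |b i k|) (∑ i, |a i| * ‖b i‖) :=
    hasSum_sum fun i _ => (l1_hasSum (b i)).mul_left _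
  refine h1.unique ?_
  convert h2 using 2 with k
  have e : (∑ i, a i • b i : L1) k = ∑ i, a i * b i k := by
    rw [lp.coeFn_sum]
    exact Finset.sum_apply k Finset.univ (fun i => (fun m => a i * b i m : ℕ → ℝ))
  rw [e]
  by_cases hk : ∃ i, b i k ≠ 0
  · obtain ⟨i, hi⟩ := hk
    have : ∀ j, j ≠ i → b j k = 0 := fun j hj => (hd j i hj k).resolve_right hi
    rw [Finset.sum_eq_single i, Finset.sum_eq_single i, abs_mul]
    · intro j _ hj; simp [this j hj]
    · simp
    · intro j _ hj; simp [this j hj]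
    · simp
  · push Not at hk
    simp [hk]

lemma l1_disjoint (x y : L1) (h1 : ‖x + y‖ = ‖x‖ + ‖y‖) (h2 : ‖x - y‖ = ‖x‖ + ‖y‖) (k : ℕ) :
    x k = 0 ∨ y k = 0 := by
  have key : ∀ z : L1, ‖x + z‖ = ‖x‖ + ‖z‖ → ∀ k, |x k + z k| = |x k| + |z k| := by
    intro z hz k
    have h := ((l1_hasSum x).add (l1_hasSum z)).sub (l1_hasSum (x + z))
    rw [hz, sub_self] at h
    have := (hasSum_zero_iff_of_nonneg ?_).1 h
    · have := congrFun this k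
      simp at this
      linarith
    · intro k
      simpa using abs_add_le (x k) (z k)
  have e1 := key y h1 k
  have e2 := key (-y) (by rw [norm_neg, ← h2, sub_eq_add_neg]) k
  simp at e2
  by_contra hh
  push Not at hh
  have p1 := abs_pos.2 hh.1
  have p2 := abs_pos.2 hh.2
  rcases abs_cases (x k) with h | h <;> rcases abs_cases (y k) with h' | h' <;>
  rcases abs_cases (x k + y k) with h3 | h3 <;> rcases abs_cases (x k + - y k) with h4 | h4 <;>
  linarith

lemma iso_imp_proj (Y : Submodule ℝ L1) {n : ℕ}
    (e : Y ≃ₗᵢ[ℝ] PiLp 1 (fun _ : Fin n => ℝ)) :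
    ∃ P : L1 →ₗ[ℝ] Y, (∀ y : Y, P y = y) ∧ ∀ x, ‖P x‖ ≤ ‖x‖ := by
  let c : Fin n → PiLp 1 (fun _ : Fin n => ℝ) := fun i => WithLp.toLp 1 (Pi.single i 1)
  let b : Fin n → Y := fun i => e.symm (c i)
  have hb1 : ∀ i, ‖(b i : L1)‖ = 1 := by
    intro i
    change ‖b i‖ = 1
    simp only [b, LinearIsometryEquiv.norm_map, c, PiLp.norm_eq_of_L1]
    rw [Finset.sum_eq_single i]
    · simp
    · intro j _ hj; simp [hj]
    · simp
  have hsum : ∀ y : Y, y = ∑ i, (e y) i • b i := by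
    intro y
    apply e.injective
    ext k
    simp [b, c, map_sum, Pi.single_apply]
  have hpm : ∀ i j, i ≠ j → ∀ s : ℝ, |s| = 1 → ‖(b i : L1) + s • b j‖ = 2 := by
    intro i j hij s hs
    change ‖b i + s • b j‖ = 2
    have : b i + s • b j = e.symm (c i + s • c j) := by simp [b]
    rw [this, LinearIsometryEquiv.norm_map, PiLp.norm_eq_of_L1]
    rw [Finset.sum_eq_add i j hij]
    · simp [c, hij, hij.symm, hs]; norm_num
    · intro k _ hk; simp [c, hk.1, hk.2]
    · simp
    · simp
  have hd : ∀ i j, i ≠ j → ∀ k, (b i : L1) k = 0 ∨ (b j : L1) k = 0 := by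
    intro i j hij k
    refine l1_disjoint _ _ ?_ ?_ k
    · have := hpm i j hij 1 (by simp)
      rw [one_smul] at this
      rw [this, hb1, hb1]; norm_num
    · have := hpm i j hij (-1) (by simp)
      rw [neg_one_smul, ← sub_eq_add_neg] at this
      rw [this, hb1, hb1]; norm_num
  let σ : Fin n → ℕ → ℝ := fun i k => SignType.sign ((b i : L1) k)
  have hσ1 : ∀ i k, |σ i k| ≤ 1 := by
    intro i k
    simp only [σ]
    rcases lt_trichotomy ((b i : L1) k) 0 with h | h | h <;> simp [h]
  have hs : ∀ i (x : L1), Summable fun k => |σ i k * x k| := fun i x => by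
    refine Summable.of_nonneg_of_le (fun _ => abs_nonneg _) (fun k => ?_) (l1_hasSum x).summable
    rw [abs_mul]
    exact mul_le_of_le_one_left (abs_nonneg _) (hσ1 i k)
  let F : Fin n → L1 →ₗ[ℝ] ℝ := fun i =>
    { toFun := fun x => ∑' k, σ i k * x k
      map_add' := fun x y => by
        rw [← (hs i x).of_abs.tsum_add (hs i y).of_abs]
        simp [mul_add]
      map_smul' := fun r x => by
        simp only [RingHom.id_apply, smul_eq_mul]
        rw [← tsum_mul_left]
        congr 1; ext k
        simp; ring }
  have hF : ∀ i j, F i (b j) = if i = j then 1 else 0 := by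
    intro i j
    change ∑' k, σ i k * (b j : L1) k = _
    split_ifs with h
    · subst h
      rw [← hb1 i, ← (l1_hasSum (b i)).tsum_eq]
      congr 1; ext k
      simp [σ]
    · convert tsum_zero with k
      rcases hd i j h k with h | h <;> simp [σ, h]
  refine ⟨∑ i, (F i).smulRight (b i), fun y => ?_, fun x => ?_⟩
  · have hy := hsum y
    have : ∀ i, F i y = e y i := by
      intro i
      conv_lhs => rw [hy]
      simp [hF]
    conv_rhs => rw [hy]
    simp [this]
  · have h1 : ‖(∑ i, (F i).smulRight (b i)) x‖ ≤ ∑ i, |F i x| := by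
      simp only [LinearMap.sum_apply, LinearMap.smulRight_apply]
      refine (norm_sum_le _ _).trans (Finset.sum_le_sum fun i _ => ?_)
      rw [norm_smul]
      have : ‖b i‖ = 1 := hb1 i
      simp [this]
    refine h1.trans ?_
    have h2 : ∑ i, |F i x| ≤ ∑ i, ∑' k, |σ i k * x k| := by
      refine Finset.sum_le_sum fun i _ => ?_
      have := norm_tsum_le_tsum_norm (f := fun k => σ i k * x k) (by simpa using hs i x)
      simp only [Real.norm_eq_abs] at this
      exact this
    refine h2.trans ?_
    rw [← Summable.tsum_finsetSum fun i _ => hs i x, ← (l1_hasSum x).tsum_eq]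
    refine Summable.tsum_le_tsum (fun k => ?_) (summable_sum fun i _ => hs i x)
      (l1_hasSum x).summable
    by_cases hk : ∃ i, (b i : L1) k ≠ 0
    · obtain ⟨i, hi⟩ := hk
      rw [Finset.sum_eq_single i]
      · rw [abs_mul]
        exact mul_le_of_le_one_left (abs_nonneg _) (hσ1 i k)
      · intro j _ hj
        have := (hd j i hj k).resolve_right hi
        simp [σ, this]
      · simp
    · push Not at hk
      simp [σ, hk]

lemma proj_imp_iso (Y : Submodule ℝ L1) [FiniteDimensional ℝ Y]
    (P : L1 →ₗ[ℝ] Y) (hP : ∀ y : Y, P y = y) (hn : ∀ x, ‖P x‖ ≤ ‖x‖) :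
    Nonempty (Y ≃ₗᵢ[ℝ] PiLp 1 (fun _ : Fin (Module.finrank ℝ Y) => ℝ)) := by
  have : ProperSpace Y := FiniteDimensional.proper ℝ Y
  let E := Set.extremePoints ℝ (Metric.closedBall (0 : Y) 1)
  have hspan : Submodule.span ℝ E = ⊤ := by
    have hkm := closure_convexHull_extremePoints (isCompact_closedBall (0 : Y) 1)
      (convex_closedBall (0 : Y) 1)
    have hsub : Metric.closedBall (0 : Y) 1 ⊆ (Submodule.span ℝ E : Set Y) := by
      rw [← hkm]
      refine closure_minimal ?_ (Submodule.closed_of_finiteDimensional _)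
      exact convexHull_min Submodule.subset_span (Submodule.convex _)
    rw [eq_top_iff]
    intro y _
    by_cases hy : y = 0
    · rw [hy]; exact Submodule.zero_mem _
    · have hy' : ‖y‖ ≠ 0 := norm_ne_zero_iff.2 hy
      have h1 : ‖y‖⁻¹ • y ∈ Submodule.span ℝ E := hsub (by
        rw [mem_closedBall_zero_iff, norm_smul, norm_inv, norm_norm, inv_mul_cancel₀ hy'])
      have := Submodule.smul_mem _ ‖y‖ h1
      rwa [smul_inv_smul₀ hy'] at this
  obtain ⟨B, hBE, hBs, hli⟩ := exists_linearIndependent ℝ E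
  have hbas : ⊤ ≤ Submodule.span ℝ (Set.range (Subtype.val : B → Y)) := by
    rw [Subtype.range_coe, hBs, hspan]
  let b0 : Module.Basis B ℝ Y := Module.Basis.mk hli hbas
  let b := b0.reindex (b0.indexEquiv (Module.finBasis ℝ Y))
  have hbE : ∀ i, b i ∈ E := by
    intro i
    simp only [b, b0, Module.Basis.reindex_apply, Module.Basis.mk_apply]
    exact hBE (Subtype.coe_prop _)
  have hb1 : ∀ i, ‖b i‖ = 1 := by
    intro i
    have h0 : ‖b i‖ ≠ 0 := norm_ne_zero_iff.2 (b.ne_zero i)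
    have hle : ‖b i‖ ≤ 1 := by simpa using extremePoints_subset (hbE i)
    have hv : ‖‖b i‖⁻¹ • b i‖ = 1 := by rw [norm_smul, norm_inv, norm_norm, inv_mul_cancel₀ h0]
    have := extreme_aux (v := ‖b i‖⁻¹ • b i) (a := ‖b i‖) (hbE i) hv.le
      (lt_of_le_of_ne (norm_nonneg _) h0.symm)
      (by rw [smul_inv_smul₀ h0, sub_self, norm_zero]; linarith)
    rw [this] at hv
    exact hv
  have hk : ∀ i k, (b i : L1) k ≠ 0 →
      ∃ s : ℝ, s ≠ 0 ∧ s • P (lp.single 1 k (1 : ℝ)) = b i := by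
    intro i k hik
    have ha : |(b i : L1) k| ≠ 0 := abs_ne_zero.2 hik
    refine ⟨|(b i : L1) k|⁻¹ * (b i : L1) k, mul_ne_zero (inv_ne_zero ha) hik, ?_⟩
    refine extreme_aux (a := |(b i : L1) k|) (hbE i) ?_ (abs_pos.2 hik) ?_
    · rw [norm_smul, norm_mul, norm_inv, Real.norm_eq_abs, Real.norm_eq_abs, abs_abs,
        inv_mul_cancel₀ ha, one_mul]
      refine (hn _).trans ?_
      rw [lp.norm_single (by simp)]; simp
    · have h1 : b i - |(b i : L1) k| • (|(b i : L1) k|⁻¹ * (b i : L1) k) •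
          P (lp.single 1 k (1 : ℝ)) = P ((b i : L1) - lp.single 1 k ((b i : L1) k)) := by
        rw [map_sub, hP, smul_smul, mul_inv_cancel_left₀ ha, ← map_smul, ← lp.single_smul]
        simp
      rw [h1]
      refine (hn _).trans ?_
      have h2 := lp.norm_compl_sum_single (p := 1) (by simp) (b i : L1) {k}
      simp at h2
      have h3 : ‖(b i : L1)‖ = 1 := hb1 i
      rw [h2]
      have : ‖b i‖ = 1 := hb1 i
      linarith
  have hd : ∀ i j, i ≠ j → ∀ k, (b i : L1) k = 0 ∨ (b j : L1) k = 0 := by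
    intro i j hij k
    by_contra hh
    push Not at hh
    obtain ⟨s, hs, hsi⟩ := hk i k hh.1
    obtain ⟨t, ht, htj⟩ := hk j k hh.2
    have h1 : t • b i = s • b j := by rw [← hsi, ← htj, smul_smul, smul_smul, mul_comm]
    have h2 := congrArg (fun y => b.repr y i) h1
    simp [hij.symm] at h2
    exact ht h2
  let e0 : Y ≃ₗ[ℝ] PiLp 1 (fun _ : Fin (Module.finrank ℝ Y) => ℝ) :=
    b.equivFun.trans (WithLp.linearEquiv 1 ℝ (Fin (Module.finrank ℝ Y) → ℝ)).symm
  refine ⟨⟨e0, fun y => ?_⟩⟩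
  rw [PiLp.norm_eq_of_L1]
  have h1 := l1_norm_sum (fun i => (b i : L1)) hd (b.repr y)
  have h2 : ‖y‖ = ‖∑ i, b.repr y i • (b i : L1)‖ := by
    conv_lhs => rw [← b.sum_repr y]
    rw [← Submodule.norm_coe]
    simp only [Submodule.coe_sum, Submodule.coe_smul]
  rw [h2, h1]
  refine Finset.sum_congr rfl fun i _ => ?_
  have : ‖(b i : L1)‖ = 1 := hb1 i
  rw [this]
  simp [e0]

end ell

theorem stmt14 (Y : Submodule ℝ (lp (fun _ : ℕ => ℝ) 1)) [FiniteDimensional ℝ Y] :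
    PropSU Y ↔
      PropU Y ∧ Nonempty (Y ≃ₗᵢ[ℝ] PiLp 1 (fun _ : Fin (Module.finrank ℝ Y) => ℝ)) := by
  constructor
  · intro h
    obtain ⟨P, hP, hn⟩ := su_imp_proj Y h
    exact ⟨su_imp_u Y h, proj_imp_iso Y P hP hn⟩
  · rintro ⟨hU, ⟨e⟩⟩
    obtain ⟨P, hP, hn⟩ := iso_imp_proj Y e
    exact proj_imp_su Y hU P hP hn

end
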